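/- Let ε, R be real numbers with 0 < ε and 14ε < R. Then arccos( ((R/2 − ε)² − 18ε²) / (R/2 − ε)² ) ≥ arccos( ((R − ε)² − 18ε²) / (R − ε)² ) + 2·arcsin( 2ε / (R − ε) ). -/

import Mathlib

theorem Real.arccos_one_sub_two_mul_sq {s : ℝ} (hs₀ : 0 ≤ s) (hs₁ : s ≤ 1) :
    Real.arccos (1 - 2 * s ^ 2) = 2 * Real.arcsin s := by
  have hcos : Real.cos (2 * Real.arcsin s) = 1 - 2 * s ^ 2 := by
    rw [Real.cos_two_mul, Real.cos_sq', Real.sin_arcsin (by linarith) hs₁]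
    ring
  rw [← hcos, Real.arccos_cos]
  · linarith [Real.arcsin_nonneg.2 hs₀]
  · linarith [Real.arcsin_le_pi_div_two s]

theorem Real.arcsin_add_arcsin_le {a b c : ℝ} (ha₀ : 0 ≤ a) (ha : a ≤ 1 / 2) (hb₀ : 0 ≤ b)
    (hb : b ≤ 1 / 2) (hc : c ≤ 1) (h : a + b ≤ c) :
    Real.arcsin a + Real.arcsin b ≤ Real.arcsin c := by
  have bound : ∀ x : ℝ, x ≤ 1 / 2 → Real.arcsin x ≤ Real.pi / 6 := fun x hx ↦ by
    refine (Real.arcsin_le_iff_le_sin' ⟨?_, ?_⟩).2 ?_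
    · linarith [Real.pi_pos]
    · linarith [Real.pi_pos]
    · rwa [Real.sin_pi_div_six]
  have hA := Real.arcsin_nonneg.2 ha₀
  have hB := Real.arcsin_nonneg.2 hb₀
  rw [Real.le_arcsin_iff_sin_le ⟨by linarith [Real.pi_pos],
    by linarith [bound a ha, bound b hb, Real.pi_pos]⟩ ⟨by linarith, hc⟩, Real.sin_add,
    Real.sin_arcsin (by linarith) (by linarith), Real.sin_arcsin (by linarith) (by linarith)]
  nlinarith [mul_le_mul_of_nonneg_left (Real.cos_le_one (Real.arcsin b)) ha₀,
    mul_le_mul_of_nonneg_right (Real.cos_le_one (Real.arcsin a)) hb₀]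

/-- The inequality between the two expressions for the angle bound `Ψ₁(ε,R)`. -/
theorem psi_one_inequality (ε R : ℝ) (hε : 0 < ε) (hR : 14 * ε < R) :
    Real.arccos (((R - ε) ^ 2 - 18 * ε ^ 2) / (R - ε) ^ 2)
        + 2 * Real.arcsin (2 * ε / (R - ε))
      ≤ Real.arccos (((R / 2 - ε) ^ 2 - 18 * ε ^ 2) / (R / 2 - ε) ^ 2) := by
  have half_angle : ∀ r : ℝ, 6 * ε ≤ r →
      Real.arccos ((r ^ 2 - 18 * ε ^ 2) / r ^ 2) = 2 * Real.arcsin (3 * ε / r) := fun r hr ↦ by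
    have hr₀ : 0 < r := by linarith
    rw [← Real.arccos_one_sub_two_mul_sq (by positivity) ((div_le_one hr₀).2 (by linarith))]
    congr 1
    field_simp
    ring
  have h₁ : 0 < R - ε := by linarith
  have h₂ : 0 < R / 2 - ε := by linarith
  rw [half_angle _ (by linarith), half_angle _ (by linarith), ← mul_add]
  refine mul_le_mul_of_nonneg_left (Real.arcsin_add_arcsin_le (by positivity) ?_ (by positivity)
    ?_ ?_ ?_) zero_le_two
  · rw [div_le_iff₀ h₁]
    linarith
  · rw [div_le_iff₀ h₁]
    linarith
  · rw [div_le_one h₂]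
    linarith
  · rw [← add_div, div_le_div_iff₀ h₁ h₂]
    nlinarith
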